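/- Boundedly many cycle-creating edges at each vertex. Under assumptions (A1) and (A2), for every x ∈ [N] and every ν > 0 there exists a constant C_ν ≥ 0 such that with ν-high probability #S_1^cyc(x) ≤ C_ν. -/

import Mathlib

open MeasureTheory Real

namespace GRG

variable {N : ℕ}

/-! ### Generic graph-theoretic definitions over an adjacency relation on `Fin N` -/

/-- The degree of a vertex with respect to an adjacency relation. -/
noncomputable def degA (A : Fin N → Fin N → Prop) (x : Fin N) : ℕ :=
  {y | A x y}.ncard

/-- The strict total order `≺`: `x ≺ y` iff `D_x < D_y`, or `D_x = D_y` and `x > y`. -/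
def precA (A : Fin N → Fin N → Prop) (x y : Fin N) : Prop :=
  degA A x < degA A y ∨ (degA A x = degA A y ∧ y < x)

/-- `γ 0, γ 1, …, γ l` is a path for the adjacency relation `A`. -/
def IsPathOn (A : Fin N → Fin N → Prop) (l : ℕ) (γ : ℕ → Fin N) : Prop :=
  ∀ i < l, A (γ i) (γ (i + 1))

/-- A path of length `l` is simple: all vertices distinct except possibly endpoints. -/
def IsSimplePath (l : ℕ) (γ : ℕ → Fin N) : Prop :=
  ∀ i j, i < j → j ≤ l → ¬(i = 0 ∧ j = l) → γ i ≠ γ j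

/-- Two paths are edge-disjoint. -/
def EdgeDisjoint (l l' : ℕ) (γ γ' : ℕ → Fin N) : Prop :=
  ∀ i < l, ∀ j < l',
    ¬((γ i = γ' j ∧ γ (i + 1) = γ' (j + 1)) ∨ (γ i = γ' (j + 1) ∧ γ (i + 1) = γ' j))

/-- `S_1^cyc(x)`: neighbours of `x` that start a simple cycle through `x`
of length at most `2r+1`. -/
def S1cycA (A : Fin N → Fin N → Prop) (r : ℕ) (x : Fin N) : Set (Fin N) :=
  {y | A x y ∧ ∃ l γ, 3 ≤ l ∧ l ≤ 2 * r + 1 ∧ γ 0 = x ∧ γ 1 = y ∧ γ l = x ∧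
    IsPathOn A l γ ∧ IsSimplePath l γ}

/-- `S_1^du(x)`: neighbours `y ∉ S_1^cyc(x)` of `x` that have a neighbour
`z ∉ S_1^cyc(y)` with `y ≺ x ≺ z`. -/
def S1duA (A : Fin N → Fin N → Prop) (r : ℕ) (x : Fin N) : Set (Fin N) :=
  {y | A x y ∧ y ∉ S1cycA A r x ∧ precA A y x ∧
    ∃ z, A y z ∧ z ∉ S1cycA A r y ∧ precA A x z}

/-- Adjacency in the graph `G^nc` (after removing the cycle-creating edges). -/
def AdjNCA (A : Fin N → Fin N → Prop) (r : ℕ) (x y : Fin N) : Prop :=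
  A x y ∧ y ∉ S1cycA A r x ∧ x ∉ S1cycA A r y

/-- Adjacency in the pruned graph `G^p` (after further removing the down-up edges). -/
def AdjPA (A : Fin N → Fin N → Prop) (r : ℕ) (x y : Fin N) : Prop :=
  AdjNCA A r x y ∧ y ∉ S1duA A r x ∧ x ∉ S1duA A r y

/-- Degree in the pruned graph. -/
noncomputable def degPA (A : Fin N → Fin N → Prop) (r : ℕ) (x : Fin N) : ℕ :=
  {y | AdjPA A r x y}.ncard

/-- `S_1^{p−}(x)`: pruned-graph neighbours of `x` that are smaller than `x` for `≺`. -/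
def S1pmA (A : Fin N → Fin N → Prop) (r : ℕ) (x : Fin N) : Set (Fin N) :=
  {y | AdjPA A r x y ∧ precA A y x}

/-- `D_x^{p−}`. -/
noncomputable def degPmA (A : Fin N → Fin N → Prop) (r : ℕ) (x : Fin N) : ℕ :=
  (S1pmA A r x).ncard

/-- `Sib^−(x)`: the smaller siblings of `x` (children of the parent of `x`
that are smaller than `x`). -/
def SibmA (A : Fin N → Fin N → Prop) (r : ℕ) (x : Fin N) : Set (Fin N) :=
  {y | ∃ p, AdjPA A r x p ∧ precA A x p ∧ AdjPA A r p y ∧ precA A y p ∧ precA A y x}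

/-- The normalization constant `Z_x` (note `2/0 = 0` in Lean, so this agrees with the
convention `Z_x = 2` when `Sib^−(x) = ∅`). -/
noncomputable def ZxA (A : Fin N → Fin N → Prop) (r : ℕ) (x : Fin N) : ℝ :=
  2 + 2 / (SibmA A r x).ncard

/-- The indicator vector of a set of vertices. -/
noncomputable def indVec (S : Set (Fin N)) : Fin N → ℝ :=
  S.indicator 1

/-- The approximate eigenvector `u_σ(x)`. -/
noncomputable def uVecA (A : Fin N → Fin N → Prop) (r : ℕ) (σ : ℝ) (x : Fin N) :
    Fin N → ℝ := fun y =>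
  (Real.sqrt (ZxA A r x))⁻¹ *
    (indVec {x} y + σ * (Real.sqrt (degPmA A r x))⁻¹ * indVec (S1pmA A r x) y -
      indVec (SibmA A r x) y / (SibmA A r x).ncard)

/-- The star vector `v_σ(x)`. -/
noncomputable def vVecA (A : Fin N → Fin N → Prop) (r : ℕ) (σ : ℝ) (x : Fin N) :
    Fin N → ℝ := fun y =>
  (Real.sqrt 2)⁻¹ *
    (indVec {x} y + σ * (Real.sqrt (degPmA A r x))⁻¹ * indVec (S1pmA A r x) y)

/-- Euclidean scalar product on `ℝ^N`. -/
noncomputable def dotR (f g : Fin N → ℝ) : ℝ := ∑ y, f y * g y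

/-- The Euclidean (`ℓ² → ℓ²`) operator norm of an `N × N` real matrix. -/
noncomputable def opNorm (M : Matrix (Fin N) (Fin N) ℝ) : ℝ :=
  ‖Matrix.toEuclideanCLM (𝕜 := ℝ) M‖

open Classical in
/-- The adjacency matrix of the pruned graph. -/
noncomputable def adjMatrixPA (A : Fin N → Fin N → Prop) (r : ℕ) :
    Matrix (Fin N) (Fin N) ℝ := fun x y => if AdjPA A r x y then 1 else 0

/-- The threshold `ξ_ν`. -/
noncomputable def xi (ν δ : ℝ) (N : ℕ) : ℝ :=
  3 * (ν + 1) * (2 - 3 * δ) / ((1 - δ) * (1 - 2 * δ)) *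
    (Real.log N / Real.log (Real.log N))

/-- The set `V_ν^{(h)}` of high-degree vertices. -/
def VhA (A : Fin N → Fin N → Prop) (ν δ : ℝ) : Set (Fin N) :=
  {x | xi ν δ N ≤ (degA A x : ℝ)}

/-- The projection `Π^p` onto the span of the vectors `u_σ(x)`, `x ∈ V_ν^{(h)}`. -/
noncomputable def PiPA (A : Fin N → Fin N → Prop) (r : ℕ) (ν δ : ℝ) :
    Matrix (Fin N) (Fin N) ℝ :=
  ∑ x : Fin N, Set.indicator (VhA A ν δ) (fun _ => (1 : ℝ)) x •
    (Matrix.vecMulVec (uVecA A r 1 x) (uVecA A r 1 x) +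
      Matrix.vecMulVec (uVecA A r (-1) x) (uVecA A r (-1) x))

/-- The block-diagonal approximation `Â`. -/
noncomputable def AhatA (A : Fin N → Fin N → Prop) (r : ℕ) (ν δ : ℝ) :
    Matrix (Fin N) (Fin N) ℝ :=
  (∑ x : Fin N, Set.indicator (VhA A ν δ) (fun _ => (1 : ℝ)) x •
    (Real.sqrt (degPmA A r x) •
      (Matrix.vecMulVec (uVecA A r 1 x) (uVecA A r 1 x) -
        Matrix.vecMulVec (uVecA A r (-1) x) (uVecA A r (-1) x)))) +
  (1 - PiPA A r ν δ) * adjMatrixPA A r * (1 - PiPA A r ν δ)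

/-! ### The generalized random graph (GRG) model -/

/-- Index set of potential edges. -/
abbrev EdgeIdx (N : ℕ) := {p : Fin N × Fin N // p.1 < p.2}

/-- The edge probabilities `p_{xy} = w_x w_y / (Σ_z w_z + w_x w_y)`. -/
noncomputable def pGRG (w : Fin N → ℝ) (x y : Fin N) : ℝ :=
  w x * w y / ((∑ z, w z) + w x * w y)

/-- Bernoulli measure with parameter `p` on `Bool`. -/
noncomputable def bern (p : ℝ) : Measure Bool :=
  ENNReal.ofReal p • Measure.dirac true + ENNReal.ofReal (1 - p) • Measure.dirac false

instance (p : ℝ) : IsFiniteMeasure (bern p) := by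
  constructor
  simp only [bern, Measure.coe_add, Measure.coe_smul, Pi.add_apply, Pi.smul_apply,
    smul_eq_mul, measure_univ, mul_one]
  exact ENNReal.add_lt_top.mpr ⟨ENNReal.ofReal_lt_top, ENNReal.ofReal_lt_top⟩

/-- The law of the GRG: independent Bernoulli edge indicators. -/
noncomputable def grgMeasure (w : Fin N → ℝ) : Measure (EdgeIdx N → Bool) :=
  Measure.pi fun e => bern (pGRG w e.val.1 e.val.2)

/-- The (random) adjacency matrix. -/
noncomputable def adjMatrix (ω : EdgeIdx N → Bool) : Matrix (Fin N) (Fin N) ℝ :=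
  fun x y =>
    if h : x < y then (if ω ⟨(x, y), h⟩ then 1 else 0)
    else if h' : y < x then (if ω ⟨(y, x), h'⟩ then 1 else 0)
    else 0

/-- The (random) adjacency relation. -/
def Adj (ω : EdgeIdx N → Bool) (x y : Fin N) : Prop := adjMatrix ω x y = 1

/-- The (random) degree `D_x`. -/
noncomputable def deg (ω : EdgeIdx N → Bool) (x : Fin N) : ℕ := degA (Adj ω) x

/-- The first empirical moment `m_1`. -/
noncomputable def m1 (w : Fin N → ℝ) : ℝ := (∑ x, w x) / N

/-- The second empirical moment `m_2`. -/
noncomputable def m2 (w : Fin N → ℝ) : ℝ := (∑ x, w x ^ 2) / N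

/-- The expected degree `d_x = E[D_x]`. -/
noncomputable def dExp (w : Fin N → ℝ) (x : Fin N) : ℝ :=
  ∫ ω, (deg ω x : ℝ) ∂(grgMeasure w)

/-- The set `W_{λ,η}` of resonant vertices. -/
def resonant (ω : EdgeIdx N → Bool) (lam η : ℝ) : Set (Fin N) :=
  {x | |Real.sqrt (deg ω x) - lam| ≤ η}

/-- The set `V*_{ν,η}` of isolated vertices. -/
noncomputable def Vstar (w : Fin N → ℝ) (ν η : ℝ) : Set (Fin N) :=
  {x | (4 * ν / 9) * Real.log N ≤ dExp w x ∧
    ∀ y, y ≠ x →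
      max (4 * Real.sqrt (ν * Real.log N * dExp w x) +
            4 * Real.sqrt (ν * Real.log N * dExp w y))
          (16 * η ^ 2) ≤ |dExp w x - dExp w y|}

end GRG

namespace GRG

/-- The edge `e` is present in the configuration `ω`. -/
def opn {N : ℕ} (ω : EdgeIdx N → Bool) (e : Sym2 (Fin N)) : Prop :=
  ∃ p : EdgeIdx N, e = s(p.1.1, p.1.2) ∧ ω p = true

lemma opn_of_adj {N : ℕ} {ω : EdgeIdx N → Bool} {a b : Fin N} (h : Adj ω a b) :
    opn ω s(a, b) := by
  unfold Adj adjMatrix at h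
  split_ifs at h with h1 h2 h3 h4
  · exact ⟨⟨(a, b), h1⟩, rfl, h2⟩
  · norm_num at h
  · exact ⟨⟨(b, a), h3⟩, Sym2.eq_swap, h4⟩
  · norm_num at h
  · norm_num at h

lemma edge_inj {N : ℕ} : Function.Injective
    (fun p : EdgeIdx N => (s(p.1.1, p.1.2) : Sym2 (Fin N))) := by
  rintro ⟨⟨a, b⟩, hab⟩ ⟨⟨c, d⟩, hcd⟩ h
  simp only [Sym2.eq_iff] at h
  simp only at hab hcd
  rcases h with ⟨rfl, rfl⟩ | ⟨rfl, rfl⟩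
  · rfl
  · exact absurd hab (not_lt.mpr hcd.le)

/-- The weight `w_a w_b / Σ w` of an edge. -/
noncomputable def qE {N : ℕ} (w : Fin N → ℝ) : Sym2 (Fin N) → ℝ :=
  Sym2.lift ⟨fun a b => w a * w b / ∑ z, w z, fun a b => by simp only [mul_comm]⟩

@[simp] lemma qE_mk {N : ℕ} (w : Fin N → ℝ) (a b : Fin N) :
    qE w s(a, b) = w a * w b / ∑ z, w z := rfl

lemma qE_nonneg {N : ℕ} (w : Fin N → ℝ) (hw : ∀ x, 0 < w x) (e : Sym2 (Fin N)) :
    0 ≤ qE w e := by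
  induction e with
  | _ a b =>
    rw [qE_mk]
    exact div_nonneg (mul_pos (hw a) (hw b)).le (Finset.sum_nonneg fun z _ => (hw z).le)

lemma p_mem {N : ℕ} (w : Fin N → ℝ) (hw : ∀ x, 0 < w x) (a b : Fin N) :
    0 ≤ pGRG w a b ∧ pGRG w a b ≤ 1 ∧ pGRG w a b ≤ qE w s(a, b) := by
  have hS : 0 < ∑ z, w z := Finset.sum_pos (fun z _ => hw z) ⟨a, Finset.mem_univ a⟩
  have hab := mul_pos (hw a) (hw b)
  unfold pGRG
  refine ⟨by positivity, ?_, ?_⟩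
  · rw [div_le_one (by positivity)]; linarith
  · rw [qE_mk]
    exact div_le_div_of_nonneg_left hab.le hS (by linarith)

lemma bern_prob {p : ℝ} (h0 : 0 ≤ p) (h1 : p ≤ 1) : IsProbabilityMeasure (bern p) := by
  constructor
  simp only [bern, Measure.coe_add, Measure.coe_smul, Pi.add_apply, Pi.smul_apply,
    smul_eq_mul, measure_univ, mul_one]
  rw [← ENNReal.ofReal_add h0 (by linarith)]
  simp

lemma bern_true (p : ℝ) : bern p {true} = ENNReal.ofReal p := by
  simp [bern]

lemma grg_prob {N : ℕ} (w : Fin N → ℝ) (hw : ∀ x, 0 < w x) :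
    IsProbabilityMeasure (grgMeasure w) := by
  unfold grgMeasure
  have : ∀ e : EdgeIdx N, IsProbabilityMeasure (bern (pGRG w e.val.1 e.val.2)) := fun e =>
    bern_prob (p_mem w hw _ _).1 (p_mem w hw _ _).2.1
  infer_instance

open Classical in
lemma grg_open_le {N : ℕ} (w : Fin N → ℝ) (hw : ∀ x, 0 < w x) (F : Finset (Sym2 (Fin N))) :
    (grgMeasure w).real {ω | ∀ e ∈ F, opn ω e} ≤ ∏ e ∈ F, qE w e := by
  have hP : ∀ e : EdgeIdx N, IsProbabilityMeasure (bern (pGRG w e.val.1 e.val.2)) := fun e =>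
    bern_prob (p_mem w hw _ _).1 (p_mem w hw _ _).2.1
  have hprob := grg_prob w hw
  by_cases hF : ∀ e ∈ F, ∃ p : EdgeIdx N, e = s(p.1.1, p.1.2)
  · set F' : Finset (EdgeIdx N) :=
      Finset.univ.filter (fun p => (s(p.1.1, p.1.2) : Sym2 (Fin N)) ∈ F) with hF'
    have himg : F'.image (fun p : EdgeIdx N => (s(p.1.1, p.1.2) : Sym2 (Fin N))) = F := by
      ext e
      simp only [Finset.mem_image, hF', Finset.mem_filter, Finset.mem_univ, true_and]
      constructor
      · rintro ⟨p, hp, rfl⟩; exact hp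
      · intro he
        obtain ⟨p, rfl⟩ := hF e he
        exact ⟨p, he, rfl⟩
    have hsub : {ω : EdgeIdx N → Bool | ∀ e ∈ F, opn ω e} ⊆
        Set.pi Set.univ (fun p => if p ∈ F' then {true} else Set.univ) := by
      intro ω hω p _
      by_cases hp : p ∈ F'
      · simp only [hp, if_true, Set.mem_singleton_iff]
        obtain ⟨p', h1, h2⟩ := hω _ (Finset.mem_filter.mp hp).2
        rw [edge_inj h1]; exact h2
      · simp [hp]
    refine (measureReal_mono hsub).trans ?_
    rw [← himg, Finset.prod_image (fun a _ b _ h => edge_inj h), Measure.real]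
    rw [grgMeasure, Measure.pi_pi, ENNReal.toReal_prod,
      ← Finset.prod_subset (Finset.subset_univ F')]
    · refine Finset.prod_le_prod (fun i _ => ENNReal.toReal_nonneg) ?_
      intro p hp
      rw [if_pos hp, bern_true, ENNReal.toReal_ofReal (p_mem w hw _ _).1]
      exact (p_mem w hw _ _).2.2
    · intro p _ hp
      rw [if_neg hp, measure_univ]; rfl
  · push Not at hF
    obtain ⟨e, he, hne⟩ := hF
    have : {ω : EdgeIdx N → Bool | ∀ e ∈ F, opn ω e} = ∅ := by
      ext ω
      simp only [Set.mem_ofPred_eq, Set.mem_empty_iff_false, iff_false]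
      intro h
      obtain ⟨p, hp, _⟩ := h e he
      exact hne p hp
    rw [this, measureReal_empty]
    exact Finset.prod_nonneg fun e _ => qE_nonneg w hw e

/-- Vertices touched by `F`, together with the root `x`. -/
def VF {N : ℕ} (x : Fin N) (F : Finset (Sym2 (Fin N))) : Finset (Fin N) :=
  insert x (F.biUnion Sym2.toFinset)

lemma card_VF {N : ℕ} (x : Fin N) (F : Finset (Sym2 (Fin N))) :
    (VF x F).card ≤ 2 * F.card + 1 := by
  unfold VF
  refine (Finset.card_insert_le _ _).trans ?_
  have := Finset.card_biUnion_le_card_mul F Sym2.toFinset 2 (fun e _ => by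
    rw [Sym2.card_toFinset]; split_ifs <;> norm_num)
  omega

/-- `g` is an ear of length `m + 1` attached to `F`, starting at `x`. -/
def IsEar {N : ℕ} (F : Finset (Sym2 (Fin N))) (m : ℕ) (g : ℕ → Fin N) : Prop :=
  (∀ i < m + 1, ∀ j < m + 1, s(g i, g (i + 1)) = s(g j, g (j + 1)) → i = j) ∧
  ∀ i < m + 1, s(g i, g (i + 1)) ∉ F

lemma exists_ear {N : ℕ} (A : Fin N → Fin N → Prop) (r : ℕ) (x : Fin N)
    (F : Finset (Sym2 (Fin N))) (h : F.card < (S1cycA A r x).ncard) :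
    ∃ m < 2 * r + 1, ∃ g : ℕ → Fin N, g 0 = x ∧ g (m + 1) ∈ VF x F ∧ IsEar F m g ∧
      ∀ i < m + 1, A (g i) (g (i + 1)) := by
  classical
  obtain ⟨y, hy, hyF⟩ : ∃ y ∈ S1cycA A r x, s(x, y) ∉ F := by
    by_contra! hcon
    have := Set.ncard_le_ncard_of_injOn (s := S1cycA A r x) (t := (F : Set (Sym2 (Fin N))))
      (fun y => s(x, y)) (fun y hy => hcon y hy)
      (fun a _ b _ hab => by
        rcases Sym2.eq_iff.mp hab with h | h
        · exact h.2
        · exact h.2.trans h.1) F.finite_toSet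
    rw [Set.ncard_coe_finset] at this
    omega
  obtain ⟨-, l, γ, hl3, hl, h0, h1, hlx, hpath, hsimp⟩ := hy
  have hex : ∃ j, γ (j + 1) ∈ VF x F := by
    refine ⟨l - 1, ?_⟩
    rw [show l - 1 + 1 = l by omega, hlx]
    exact Finset.mem_insert_self _ _
  set m := Nat.find hex with hm
  have hmV : γ (m + 1) ∈ VF x F := Nat.find_spec hex
  have hml : m ≤ l - 1 := Nat.find_min' hex (by
    rw [show l - 1 + 1 = l by omega, hlx]
    exact Finset.mem_insert_self _ _)
  have hmin : ∀ j < m, γ (j + 1) ∉ VF x F := fun j hj => Nat.find_min hex hj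
  have key : ∀ i j, i < j → j < l → s(γ i, γ (i + 1)) ≠ s(γ j, γ (j + 1)) := by
    intro i j hij hj he
    rw [Sym2.eq_iff] at he
    rcases he with ⟨ha, _⟩ | ⟨ha, hb⟩
    · exact hsimp i j hij hj.le (by omega) ha
    · by_cases hc : i = 0 ∧ j + 1 = l
      · exact hsimp (i + 1) j (by omega) hj.le (by omega) hb
      · exact hsimp i (j + 1) (by omega) (by omega) hc ha
  refine ⟨m, by omega, γ, h0, hmV, ⟨?_, ?_⟩, fun i hi => hpath i (by omega)⟩
  · intro i hi j hj he
    rcases lt_trichotomy i j with hij | hij | hij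
    · exact absurd he (key i j hij (by omega))
    · exact hij
    · exact absurd he.symm (key j i hij (by omega))
  · intro i hi hF
    rcases i with _ | i
    · rw [h0, h1] at hF; exact hyF hF
    · apply hmin i (by omega)
      unfold VF
      refine Finset.mem_insert_of_mem (Finset.mem_biUnion.mpr ⟨_, hF, ?_⟩)
      simp

/-- The path `x, v 0, …, v (m-1), z`. -/
def pth {N : ℕ} (x : Fin N) (m : ℕ) (z : Fin N) (v : Fin m → Fin N) : ℕ → Fin N
  | 0 => x
  | i + 1 => if h : i < m then v ⟨i, h⟩ else z

lemma prod_pth {N : ℕ} (w : Fin N → ℝ) (x : Fin N) (m : ℕ) (z : Fin N) (v : Fin m → Fin N) :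
    ∏ i ∈ Finset.range (m + 1), qE w s(pth x m z v i, pth x m z v (i + 1)) =
      (w x * w z / ∑ y, w y) * ∏ i : Fin m, (w (v i) ^ 2 / ∑ y, w y) := by
  simp only [qE_mk]
  rw [Finset.prod_div_distrib, Finset.prod_mul_distrib, Finset.prod_range_succ',
    Finset.prod_range_succ (fun i => w (pth x m z v (i + 1))), Finset.prod_const,
    Finset.card_range, Finset.prod_div_distrib, Finset.prod_const, Finset.card_univ,
    Fintype.card_fin]
  have e1 : ∏ i ∈ Finset.range m, w (pth x m z v (i + 1)) = ∏ i : Fin m, w (v i) := by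
    rw [Finset.prod_range]
    refine Finset.prod_congr rfl fun i _ => ?_
    simp [pth]
  have e2 : pth x m z v (m + 1) = z := by simp [pth]
  have e3 : pth x m z v 0 = x := rfl
  rw [e1, e2, e3, Finset.prod_pow, pow_succ (∑ y, w y) m, div_mul_div_comm]
  congr 1 <;> ring

lemma sum_pth {N : ℕ} (w : Fin N → ℝ) (x : Fin N) (m : ℕ) (z : Fin N) :
    ∑ v : Fin m → Fin N,
      ∏ i ∈ Finset.range (m + 1), qE w s(pth x m z v i, pth x m z v (i + 1)) =
      (w x * w z / ∑ y, w y) * ((∑ y, w y ^ 2) / ∑ y, w y) ^ m := by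
  simp only [prod_pth]
  rw [← Finset.mul_sum, ← Fintype.sum_pow (fun y => w y ^ 2 / ∑ y, w y) m, ← Finset.sum_div]

open Classical in
lemma main_ind {N : ℕ} (w : Fin N → ℝ) (hw : ∀ x, 0 < w x) (r : ℕ) (x : Fin N)
    (a K : ℝ) (hK1 : 1 ≤ K) (ha : ∀ z, w x * w z / ∑ y, w y ≤ a)
    (hK : (∑ y, w y ^ 2) / ∑ y, w y ≤ K) (M : ℕ) (k : ℕ) :
    ∀ F : Finset (Sym2 (Fin N)), F.card + (2 * r + 1) * k ≤ M →
    (grgMeasure w).real {ω | (∀ e ∈ F, opn ω e) ∧ M ≤ (S1cycA (Adj ω) r x).ncard} ≤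
      ((2 * r + 1) * (2 * M + 1) * (a * K ^ (2 * r))) ^ k * ∏ e ∈ F, qE w e := by
  have hprob := grg_prob w hw
  have hS : 0 < ∑ y, w y := Finset.sum_pos (fun z _ => hw z) ⟨x, Finset.mem_univ x⟩
  have hS2 : 0 ≤ (∑ y, w y ^ 2) / ∑ y, w y :=
    div_nonneg (Finset.sum_nonneg fun _ _ => sq_nonneg _) hS.le
  have ha0 : 0 ≤ a := le_trans (div_nonneg (mul_pos (hw x) (hw x)).le hS.le) (ha x)
  induction k with
  | zero =>
    intro F _
    rw [pow_zero, one_mul]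
    refine le_trans (measureReal_mono ?_) (grg_open_le w hw F)
    exact fun ω h => h.1
  | succ k ih =>
    intro F hF
    set B : ℝ := (2 * r + 1) * (2 * M + 1) * (a * K ^ (2 * r)) with hB
    have hB0 : 0 ≤ B := by positivity
    set Q := ∏ e ∈ F, qE w e with hQ
    have hQ0 : 0 ≤ Q := Finset.prod_nonneg fun e _ => qE_nonneg w hw e
    let T : (m : ℕ) → Fin N → (Fin m → Fin N) → Set (EdgeIdx N → Bool) := fun m z v =>
      {ω | IsEar F m (pth x m z v) ∧
        (∀ e ∈ F ∪ (Finset.range (m + 1)).image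
          (fun i => s(pth x m z v i, pth x m z v (i + 1))), opn ω e) ∧
        M ≤ (S1cycA (Adj ω) r x).ncard}
    have hsub : {ω | (∀ e ∈ F, opn ω e) ∧ M ≤ (S1cycA (Adj ω) r x).ncard} ⊆
        ⋃ m ∈ Finset.range (2 * r + 1), ⋃ z ∈ VF x F,
          ⋃ v ∈ (Finset.univ : Finset (Fin m → Fin N)), T m z v := by
      rintro ω ⟨hω, hM⟩
      have hlt : F.card < (S1cycA (Adj ω) r x).ncard := by
        have : (2 * r + 1) * (k + 1) = (2 * r + 1) * k + 2 * r + 1 := by ring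
        omega
      obtain ⟨m, hm, g, g0, gV, gE, gA⟩ := exists_ear (Adj ω) r x F hlt
      simp only [Set.mem_iUnion]
      have hg : ∀ i ≤ m + 1, pth x m (g (m + 1)) (fun i => g (i + 1)) i = g i := by
        intro i hi
        rcases i with _ | i
        · exact g0.symm
        · simp only [pth]
          split_ifs with h
          · rfl
          · rw [show i = m by omega]
      refine ⟨m, Finset.mem_range.mpr hm, g (m + 1), gV, fun i => g (i + 1),
        Finset.mem_univ _, ⟨?_, ?_⟩, ?_, hM⟩
      · intro i hi j hj h
        rw [hg i (by omega), hg j (by omega), hg (i + 1) (by omega), hg (j + 1) (by omega)] at h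
        exact gE.1 i hi j hj h
      · intro i hi
        rw [hg i (by omega), hg (i + 1) (by omega)]
        exact gE.2 i hi
      · intro e he
        rcases Finset.mem_union.mp he with he | he
        · exact hω e he
        · obtain ⟨i, hi, rfl⟩ := Finset.mem_image.mp he
          have hi := Finset.mem_range.mp hi
          rw [hg i (by omega), hg (i + 1) (by omega)]
          exact opn_of_adj (gA i hi)
    have hT : ∀ m < 2 * r + 1, ∀ z v, (grgMeasure w).real (T m z v) ≤
        B ^ k * Q *
          ∏ i ∈ Finset.range (m + 1), qE w s(pth x m z v i, pth x m z v (i + 1)) := by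
      intro m hm z v
      have hp0 : 0 ≤ ∏ i ∈ Finset.range (m + 1),
          qE w s(pth x m z v i, pth x m z v (i + 1)) :=
        Finset.prod_nonneg fun e _ => qE_nonneg w hw _
      by_cases hE : IsEar F m (pth x m z v)
      · have hcard := Finset.card_union_le F ((Finset.range (m + 1)).image
          (fun i => s(pth x m z v i, pth x m z v (i + 1))))
        have hcard2 := Finset.card_image_le (s := Finset.range (m + 1))
          (f := fun i => s(pth x m z v i, pth x m z v (i + 1)))
        rw [Finset.card_range] at hcard2
        have hh : (2 * r + 1) * (k + 1) = (2 * r + 1) * k + 2 * r + 1 := by ring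
        have := ih (F ∪ (Finset.range (m + 1)).image
          (fun i => s(pth x m z v i, pth x m z v (i + 1)))) (by omega)
        rw [Finset.prod_union, Finset.prod_image, ← mul_assoc] at this
        · refine le_trans (measureReal_mono ?_) this
          exact fun ω h => h.2
        · intro i hi j hj h
          exact hE.1 i (by simpa using hi) j (by simpa using hj) h
        · rw [Finset.disjoint_right]
          intro e he
          obtain ⟨i, hi, rfl⟩ := Finset.mem_image.mp he
          exact hE.2 i (Finset.mem_range.mp hi)
      · have : T m z v = ∅ := by
          ext ω
          simp only [T, Set.mem_ofPred_eq, Set.mem_empty_iff_false, iff_false]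
          exact fun h => hE h.1
        rw [this, measureReal_empty]
        positivity
    refine (measureReal_mono hsub (measure_ne_top _ _)).trans ?_
    have step1 : ∀ m < 2 * r + 1, ∀ z,
        (grgMeasure w).real (⋃ v ∈ (Finset.univ : Finset (Fin m → Fin N)), T m z v) ≤
        B ^ k * Q * (a * K ^ (2 * r)) := by
      intro m hm z
      refine (measureReal_biUnion_finset_le _ _).trans ?_
      refine (Finset.sum_le_sum fun v _ => hT m hm z v).trans ?_
      rw [← Finset.mul_sum, sum_pth]
      refine mul_le_mul_of_nonneg_left ?_ (by positivity)
      refine mul_le_mul (ha z) ?_ (by positivity) ha0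
      exact (pow_le_pow_left₀ hS2 hK m).trans (pow_le_pow_right₀ hK1 (by omega))
    have step2 : ∀ m < 2 * r + 1,
        (grgMeasure w).real (⋃ z ∈ VF x F,
          ⋃ v ∈ (Finset.univ : Finset (Fin m → Fin N)), T m z v) ≤
        (2 * M + 1) * (B ^ k * Q * (a * K ^ (2 * r))) := by
      intro m hm
      refine (measureReal_biUnion_finset_le _ _).trans ?_
      refine (Finset.sum_le_sum fun z _ => step1 m hm z).trans ?_
      rw [Finset.sum_const, nsmul_eq_mul]
      refine mul_le_mul_of_nonneg_right ?_ (by positivity)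
      have := card_VF x F
      have : (VF x F).card ≤ 2 * M + 1 := by
        have : 0 ≤ (2 * r + 1) * (k + 1) := Nat.zero_le _
        omega
      exact_mod_cast this
    refine (measureReal_biUnion_finset_le _ _).trans ?_
    refine (Finset.sum_le_sum fun m hm => step2 m (Finset.mem_range.mp hm)).trans ?_
    rw [Finset.sum_const, nsmul_eq_mul, Finset.card_range]
    push_cast
    apply le_of_eq
    rw [pow_succ, hB]
    ring

end GRG

open GRG in
/-- Boundedly many cycle-creating edges at each vertex.
Under (A1) and (A2), for every `ν > 0` there is `C_ν ≥ 0` such that for every vertex `x`,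
with `ν`-high probability `#S_1^cyc(x) ≤ C_ν`. -/
theorem card_S1cyc_bounded
    (ε δ : ℝ) (hε : 0 < ε) (hε' : ε < 1 / 2) (hδ : 0 < δ) (hδ' : δ < 1 / 3)
    (r : ℕ) (hr : 6 ≤ r)
    (w : (N : ℕ) → Fin N → ℝ)
    (hpos : ∀ N x, 0 < w N x)
    (hA1 : ∀ N x, w N x ≤ (N : ℝ) ^ ((1 : ℝ) / 2 - ε))
    (hA2m1 : ∀ N : ℕ, 1 ≤ N → (N : ℝ) ^ (-ε) ≤ m1 (w N))
    (hA2m2 : ∃ C > 0, ∀ N : ℕ, 2 ≤ N → m2 (w N) / m1 (w N) ≤ C * Real.log N ^ δ)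
    (ν : ℝ) (hν : 0 < ν) :
    ∃ Cν : ℝ, 0 ≤ Cν ∧ ∃ C > (0 : ℝ), ∀ (N : ℕ) (x : Fin N),
      1 - ENNReal.ofReal (C * (N : ℝ) ^ (-ν)) ≤
        grgMeasure (w N) {ω | ((S1cycA (Adj ω) r x).ncard : ℝ) ≤ Cν} := by
  obtain ⟨C0, hC0, hm2⟩ := hA2m2
  have hr0 : (0 : ℝ) < r := by exact_mod_cast (by omega : 0 < r)
  set η : ℝ := ε / (4 * r) with hη
  have hη0 : 0 < η := by positivity
  set D0 : ℝ := 1 + C0 * (1 + 1 / η) with hD0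
  have hD0pos : 1 ≤ D0 := by
    have : 0 ≤ C0 * (1 + 1 / η) := by positivity
    linarith
  set k : ℕ := ⌈2 * ν / ε⌉₊ with hk
  have hkν : ν ≤ ε / 2 * k := by
    have h1 : 2 * ν / ε ≤ k := Nat.le_ceil _
    rw [div_le_iff₀ hε] at h1
    linarith
  set M : ℕ := (2 * r + 1) * k with hM
  set E : ℝ := ((2 * r + 1) * (2 * M + 1) * D0 ^ (2 * r)) ^ k with hE
  have hE0 : 0 ≤ E := by positivity
  refine ⟨M, by positivity, E + 1, by positivity, ?_⟩
  intro N x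
  have hprob := grg_prob (w N) (hpos N)
  have hN1 : 1 ≤ N := by have := x.2; omega
  rcases Nat.lt_or_ge N 2 with hN | hN
  · have : N = 1 := by omega
    subst this
    have h1 : (1 : ENNReal) ≤ ENNReal.ofReal ((E + 1) * ((1 : ℕ) : ℝ) ^ (-ν)) := by
      rw [Nat.cast_one, Real.one_rpow, mul_one, ← ENNReal.ofReal_one]
      exact ENNReal.ofReal_le_ofReal (by linarith)
    rw [tsub_eq_zero_of_le h1]
    exact zero_le
  have hNR : (1 : ℝ) ≤ N := by exact_mod_cast hN1
  have hN0 : (0 : ℝ) < N := by linarith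
  have hS : 0 < ∑ y, w N y := Finset.sum_pos (fun z _ => hpos N z) ⟨x, Finset.mem_univ x⟩
  have hSlow : (N : ℝ) ^ (1 - ε) ≤ ∑ y, w N y := by
    have h := hA2m1 N hN1
    unfold m1 at h
    rw [le_div_iff₀ hN0] at h
    calc (N : ℝ) ^ (1 - ε) = (N : ℝ) ^ (-ε) * N := by
          rw [show 1 - ε = -ε + 1 by ring, Real.rpow_add_one hN0.ne']
      _ ≤ _ := h
  have ha : ∀ z, w N x * w N z / ∑ y, w N y ≤ (N : ℝ) ^ (-ε) := by
    intro z
    rw [div_le_iff₀ hS]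
    calc w N x * w N z ≤ (N : ℝ) ^ ((1 : ℝ) / 2 - ε) * (N : ℝ) ^ ((1 : ℝ) / 2 - ε) :=
          mul_le_mul (hA1 N x) (hA1 N z) (hpos N z).le (by positivity)
      _ = (N : ℝ) ^ (-ε) * (N : ℝ) ^ (1 - ε) := by
          rw [← Real.rpow_add hN0, ← Real.rpow_add hN0]; congr 1; ring
      _ ≤ _ := mul_le_mul_of_nonneg_left hSlow (by positivity)
  have hNη : 1 ≤ (N : ℝ) ^ η := Real.one_le_rpow hNR hη0.le
  have hlog0 : 0 ≤ Real.log N := Real.log_nonneg hNR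
  have hlog : Real.log N ^ δ ≤ (1 + 1 / η) * (N : ℝ) ^ η := by
    have h1 : Real.log N ≤ (N : ℝ) ^ η / η := Real.log_le_rpow_div hN0.le hη0
    have h2 : Real.log N ^ δ ≤ 1 + Real.log N := by
      rcases le_total (Real.log N) 1 with h | h
      · have := Real.rpow_le_one hlog0 h hδ.le
        linarith
      · have := Real.rpow_le_rpow_of_exponent_le h (show δ ≤ 1 by linarith)
        rw [Real.rpow_one] at this
        linarith
    calc Real.log N ^ δ ≤ 1 + Real.log N := h2
      _ ≤ (N : ℝ) ^ η + (N : ℝ) ^ η / η := add_le_add hNη h1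
      _ = _ := by ring
  have hK : (∑ y, w N y ^ 2) / ∑ y, w N y ≤ D0 * (N : ℝ) ^ η := by
    have h := hm2 N hN
    unfold m2 m1 at h
    rw [div_div_div_cancel_right₀ hN0.ne'] at h
    calc _ ≤ C0 * Real.log N ^ δ := h
      _ ≤ C0 * ((1 + 1 / η) * (N : ℝ) ^ η) := mul_le_mul_of_nonneg_left hlog hC0.le
      _ = C0 * (1 + 1 / η) * (N : ℝ) ^ η := by ring
      _ ≤ _ := mul_le_mul_of_nonneg_right (by linarith) (by positivity)
  have hmain := main_ind (w N) (hpos N) r x ((N : ℝ) ^ (-ε)) (D0 * (N : ℝ) ^ η)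
    (by nlinarith) ha hK M k ∅ (by simp [hM])
  rw [Finset.prod_empty, mul_one] at hmain
  have hpow : ((N : ℝ) ^ η) ^ (2 * r) = (N : ℝ) ^ (ε / 2) := by
    rw [← Real.rpow_natCast, ← Real.rpow_mul hN0.le]
    congr 1
    rw [hη]; push_cast; field_simp; norm_num
  have hBk : ((2 * r + 1) * (2 * M + 1) * ((N : ℝ) ^ (-ε) * (D0 * (N : ℝ) ^ η) ^ (2 * r))) ^ k
      ≤ (E + 1) * (N : ℝ) ^ (-ν) := by
    have e1 : (N : ℝ) ^ (-ε) * (D0 * (N : ℝ) ^ η) ^ (2 * r) =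
        D0 ^ (2 * r) * (N : ℝ) ^ (-(ε / 2)) := by
      rw [mul_pow, hpow, show -(ε / 2) = -ε + ε / 2 by ring, Real.rpow_add hN0]; ring
    rw [e1, ← mul_assoc, mul_pow, ← hE]
    refine mul_le_mul (by linarith) ?_ (by positivity) (by positivity)
    rw [← Real.rpow_natCast, ← Real.rpow_mul hN0.le]
    exact Real.rpow_le_rpow_of_exponent_le hNR (by linarith)
  have hfin := hmain.trans hBk
  rw [tsub_le_iff_right]
  set s : Set (EdgeIdx N → Bool) := {ω | ((S1cycA (Adj ω) r x).ncard : ℝ) ≤ M} with hs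
  have hcompl : grgMeasure (w N) sᶜ ≤ ENNReal.ofReal ((E + 1) * (N : ℝ) ^ (-ν)) := by
    rw [ENNReal.le_ofReal_iff_toReal_le (measure_ne_top _ _) (by positivity)]
    refine le_trans (measureReal_mono ?_) hfin
    intro ω hω
    refine ⟨by simp, ?_⟩
    by_contra hlt
    apply hω
    have : (S1cycA (Adj ω) r x).ncard ≤ M := by omega
    exact (by exact_mod_cast this : ((S1cycA (Adj ω) r x).ncard : ℝ) ≤ M)
  calc (1 : ENNReal) = grgMeasure (w N) Set.univ := measure_univ.symm
    _ ≤ grgMeasure (w N) s + grgMeasure (w N) sᶜ := measure_univ_le_add_compl s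
    _ ≤ _ := by gcongr
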